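/- arXiv:1712.05481 — 5 statements merged into one kernel-verified Lean document; each statement's English description precedes it below -/
import Mathlib

section
/- Let f ∈ R[x_1,…,x_n] be a nonzero polynomial with t = #f terms, let p be a positive integer, and let s ∈ ℕ^n. If k = #(f^mod_(p)(x^s)) is the number of nonzero terms of the reduced univariate polynomial, then t − k ≤ C_f(p,s) ≤ 2(t − k). -/
open scoped Classical

noncomputable section

/-- Dot product of a substitution vector `s` with an exponent vector `e`. -/
def dotProd {n : ℕ} (s : Fin n → ℕ) (e : Fin n →₀ ℕ) : ℕ := ∑ i, s i * e i

/-- The univariate polynomial `f(x^s)` obtained by the Kronecker substitution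
`x_i = x^(s i)`. -/
def kron {R : Type*} [CommRing R] {n : ℕ} (s : Fin n → ℕ)
    (f : MvPolynomial (Fin n) R) : Polynomial R :=
  MvPolynomial.eval₂ Polynomial.C (fun i => Polynomial.X ^ s i) f

/-- `f^mod_(p)(x^s) := f(x^s) mod (x^p - 1)`. -/
def kronMod {R : Type*} [CommRing R] {n : ℕ} (p : ℕ) (s : Fin n → ℕ)
    (f : MvPolynomial (Fin n) R) : Polynomial R :=
  kron s f %ₘ (Polynomial.X ^ p - 1)

/-- The term of `f` with exponent vector `e` collides in `f^mod_(p)(x^s)`: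
`f` has another term with exponent vector `e' ≠ e` such that
`s·e ≡ s·e' (mod p)`. -/
def Collides {R : Type*} [CommRing R] {n : ℕ} (f : MvPolynomial (Fin n) R)
    (p : ℕ) (s : Fin n → ℕ) (e : Fin n →₀ ℕ) : Prop :=
  ∃ e' ∈ f.support, e' ≠ e ∧ dotProd s e ≡ dotProd s e' [MOD p]

/-- `C_f(p,s)`: the number of terms of `f` that collide in `f^mod_(p)(x^s)`. -/
def numCollide {R : Type*} [CommRing R] {n : ℕ} (f : MvPolynomial (Fin n) R)
    (p : ℕ) (s : Fin n → ℕ) : ℕ :=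
  (f.support.filter (fun e => Collides f p s e)).card

/-- The substitution vector `s + p·I_k`. -/
def sShift {n : ℕ} (s : Fin n → ℕ) (p : ℕ) (k : Fin n) : Fin n → ℕ :=
  fun j => if j = k then s j + p else s j

/-- Reducing a monomial modulo `X ^ p - 1` reduces its exponent modulo `p`. -/
theorem monomial_modByMonic_X_pow_sub_one {R : Type*} [CommRing R] {p : ℕ} (hp : 0 < p)
    (m : ℕ) (a : R) :
    Polynomial.monomial m a %ₘ (Polynomial.X ^ p - 1) = Polynomial.monomial (m % p) a := by
  nontriviality R
  have hq : (Polynomial.X ^ p - 1 : Polynomial R).Monic := by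
    simpa using Polynomial.monic_X_pow_sub_C (1 : R) hp.ne'
  have hdeg : (Polynomial.X ^ p - 1 : Polynomial R).degree = p := by
    simpa using Polynomial.degree_X_pow_sub_C hp (1 : R)
  have hdvd : (Polynomial.X ^ p - 1 : Polynomial R) ∣
      Polynomial.monomial m a - Polynomial.monomial (m % p) a := by
    have h : Polynomial.monomial m a - Polynomial.monomial (m % p) a =
        ((Polynomial.X ^ p) ^ (m / p) - 1 ^ (m / p)) * Polynomial.monomial (m % p) a := by
      rw [one_pow, sub_mul, one_mul, ← pow_mul, Polynomial.X_pow_mul_monomial, Nat.mod_add_div]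
    rw [h]
    exact (sub_dvd_pow_sub_pow _ _ _).mul_right _
  rw [Polynomial.modByMonic_eq_of_dvd_sub hq hdvd, Polynomial.modByMonic_eq_self_iff hq, hdeg]
  exact (Polynomial.degree_monomial_le _ _).trans_lt (by exact_mod_cast Nat.mod_lt m hp)

theorem kron_eq_sum {R : Type*} [CommRing R] {n : ℕ} (s : Fin n → ℕ)
    (f : MvPolynomial (Fin n) R) :
    kron s f = ∑ e ∈ f.support, Polynomial.monomial (dotProd s e) (f.coeff e) := by
  simp only [kron, MvPolynomial.eval₂_eq', dotProd, ← pow_mul, Finset.prod_pow_eq_pow_sum,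
    Polynomial.C_mul_X_pow_eq_monomial]

theorem kronMod_eq_sum {R : Type*} [CommRing R] {n : ℕ} {p : ℕ} (hp : 0 < p) (s : Fin n → ℕ)
    (f : MvPolynomial (Fin n) R) :
    kronMod p s f = ∑ e ∈ f.support, Polynomial.monomial (dotProd s e % p) (f.coeff e) := by
  rw [kronMod, kron_eq_sum, ← Polynomial.modByMonicHom_apply, map_sum]
  simp only [Polynomial.modByMonicHom_apply, monomial_modByMonic_X_pow_sub_one hp]

theorem coeff_kronMod {R : Type*} [CommRing R] {n : ℕ} {p : ℕ} (hp : 0 < p) (s : Fin n → ℕ)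
    (f : MvPolynomial (Fin n) R) (j : ℕ) :
    (kronMod p s f).coeff j = ∑ e ∈ f.support with dotProd s e % p = j, f.coeff e := by
  simp only [kronMod_eq_sum hp, Polynomial.finsetSum_coeff, Polynomial.coeff_monomial,
    Finset.sum_filter]

theorem support_kronMod_subset {R : Type*} [CommRing R] {n : ℕ} {p : ℕ} (hp : 0 < p)
    (s : Fin n → ℕ) (f : MvPolynomial (Fin n) R) :
    (kronMod p s f).support ⊆ f.support.image fun e => dotProd s e % p := by
  intro j hj
  rw [Polynomial.mem_support_iff, coeff_kronMod hp] at hj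
  obtain ⟨e, he, -⟩ := Finset.exists_ne_zero_of_sum_ne_zero hj
  rw [Finset.mem_filter] at he
  exact Finset.mem_image.2 ⟨e, he⟩

/-- A term that does not collide survives in the reduced polynomial. -/
theorem mod_mem_support_kronMod {R : Type*} [CommRing R] {n : ℕ} {p : ℕ} (hp : 0 < p)
    (s : Fin n → ℕ) (f : MvPolynomial (Fin n) R) {e : Fin n →₀ ℕ} (he : e ∈ f.support)
    (h : ¬ Collides f p s e) : dotProd s e % p ∈ (kronMod p s f).support := by
  rw [Polynomial.mem_support_iff, coeff_kronMod hp]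
  have hs : {e' ∈ f.support | dotProd s e' % p = dotProd s e % p} = {e} := by
    ext e'
    simp only [Finset.mem_filter, Finset.mem_singleton]
    refine ⟨fun ⟨h₁, h₂⟩ => ?_, by rintro rfl; exact ⟨he, rfl⟩⟩
    by_contra hne
    exact h ⟨e', h₁, hne, h₂.symm⟩
  rw [hs, Finset.sum_singleton]
  exact MvPolynomial.mem_support_iff.1 he

theorem card_not_collides_le {R : Type*} [CommRing R] {n : ℕ} {p : ℕ} (hp : 0 < p)
    (s : Fin n → ℕ) (f : MvPolynomial (Fin n) R) :
    (f.support.filter fun e => ¬ Collides f p s e).card ≤ (kronMod p s f).support.card := by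
  refine Finset.card_le_card_of_injOn (fun e => dotProd s e % p) (fun e he => ?_)
    fun e he e' he' hee' => ?_
  · have he := Finset.mem_filter.1 he
    exact mod_mem_support_kronMod hp s f he.1 he.2
  · by_contra hne
    exact (Finset.mem_filter.1 he).2 ⟨e', (Finset.mem_filter.1 he').1, Ne.symm hne, hee'⟩

/-- Every residue class met by a colliding term contains at least two colliding terms. -/
theorem two_mul_card_image_collides_le {R : Type*} [CommRing R] {n : ℕ} (p : ℕ)
    (s : Fin n → ℕ) (f : MvPolynomial (Fin n) R) :
    2 * ((f.support.filter fun e => Collides f p s e).image fun e => dotProd s e % p).card ≤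
      numCollide f p s := by
  refine Finset.mul_card_image_le_card _ 2 fun b hb => ?_
  obtain ⟨e, he, rfl⟩ := Finset.mem_image.1 hb
  obtain ⟨he₁, e', he', hne, hmod⟩ := Finset.mem_filter.1 he
  exact Finset.one_lt_card.2 ⟨e, Finset.mem_filter.2 ⟨he, rfl⟩, e',
    Finset.mem_filter.2 ⟨Finset.mem_filter.2 ⟨he', e, he₁, hne.symm, hmod.symm⟩, hmod.symm⟩,
    hne.symm⟩

theorem card_support_kronMod_le {R : Type*} [CommRing R] {n : ℕ} {p : ℕ} (hp : 0 < p)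
    (s : Fin n → ℕ) (f : MvPolynomial (Fin n) R) :
    (kronMod p s f).support.card ≤
      ((f.support.filter fun e => Collides f p s e).image fun e => dotProd s e % p).card +
        (f.support.filter fun e => ¬ Collides f p s e).card := by
  refine (Finset.card_le_card (support_kronMod_subset hp s f)).trans ?_
  rw [← Finset.filter_union_filter_not_eq (fun e => Collides f p s e) f.support,
    Finset.image_union, Finset.filter_union_filter_not_eq]
  exact (Finset.card_union_le _ _).trans (Nat.add_le_add_left Finset.card_image_le _)

theorem num_collide_bounds {R : Type*} [CommRing R] {n : ℕ}
    (f : MvPolynomial (Fin n) R) (hf : f ≠ 0)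
    (t : ℕ) (ht : t = f.support.card)
    (p : ℕ) (hp : 0 < p) (s : Fin n → ℕ)
    (k : ℕ) (hk : k = (kronMod p s f).support.card) :
    t - k ≤ numCollide f p s ∧ numCollide f p s ≤ 2 * (t - k) := by
  have h₁ := card_not_collides_le hp s f
  have h₂ := two_mul_card_image_collides_le p s f
  have h₃ := card_support_kronMod_le hp s f
  have h₄ : numCollide f p s + (f.support.filter fun e => ¬ Collides f p s e).card =
      f.support.card := Finset.card_filter_add_card_filter_not _
  omega

end
end

section
/- Let f = Σ_{i=1}^t c_i m_i ∈ R[x_1,…,x_n] be nonzero, let T ≥ #f and D ≥ deg f, let N = max{31·⌊(T−1)·log₂ D⌋, 1}, and let p_1, …, p_N be N distinct primes with p_i ≥ 32(T−1) for each i. Fix one term c_j m_j of f. If a prime p is chosen uniformly at random from {p_1,…,p_N} and then s is chosen uniformly at random from Z_p^n = {0,1,…,p−1}^n, then the probability that c_j m_j collides in f^mod_(p)(x^s) is at most 1/16; equivalently, Σ_{i=1}^N (1/p_i^n)·#{s ∈ Z_{p_i}^n : c_j m_j collides in f^mod_(p_i)(x^s)} ≤ N/16. -/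
open scoped Classical

noncomputable section

/-- In `(ℤ/p)^n` the hyperplane of vectors having the same dot product with `e` and `e'` contains
at most a fraction `1/p` of all vectors, provided that `e` and `e'` differ modulo `p`. -/
lemma mul_card_dotProd_modEq_le {n p : ℕ} (hp : p.Prime) (e e' : Fin n →₀ ℕ) (k : Fin n)
    (hk : ¬ e k ≡ e' k [MOD p]) :
    p * (Finset.univ.filter (fun s : Fin n → Fin p =>
      dotProd (fun k => (s k : ℕ)) e ≡ dotProd (fun k => (s k : ℕ)) e' [MOD p])).card ≤ p ^ n := by
  have : Fact p.Prime := ⟨hp⟩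
  have hcard : (Finset.univ.filter (fun s : Fin n → Fin p =>
      dotProd (fun k => (s k : ℕ)) e ≡ dotProd (fun k => (s k : ℕ)) e' [MOD p])).card ≤
      (Finset.univ : Finset ({j : Fin n // j ≠ k} → Fin p)).card := by
    refine Finset.card_le_card_of_injOn (fun s j => s j) (fun _ _ => Finset.mem_univ _) ?_
    intro s hs t ht hst
    have hoff : ∀ j, j ≠ k → s j = t j := fun j hj => congrFun hst ⟨j, hj⟩
    have key : ∀ u : Fin n → Fin p,
        dotProd (fun k => (u k : ℕ)) e ≡ dotProd (fun k => (u k : ℕ)) e' [MOD p] →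
        ((u k : ℕ) : ZMod p) * ((e k : ZMod p) - e' k) +
          ∑ j ∈ Finset.univ.erase k, ((u j : ℕ) : ZMod p) * ((e j : ZMod p) - e' j) = 0 := by
      intro u hu
      rw [Finset.add_sum_erase Finset.univ
        (fun j => ((u j : ℕ) : ZMod p) * ((e j : ZMod p) - e' j)) (Finset.mem_univ k)]
      have h := (ZMod.natCast_eq_natCast_iff _ _ _).2 hu
      simp only [dotProd, Nat.cast_sum, Nat.cast_mul] at h
      simp only [mul_sub, Finset.sum_sub_distrib, h, sub_self]
    have h1 := key s (Finset.mem_filter.1 hs).2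
    have h2 := key t (Finset.mem_filter.1 ht).2
    have hsum : ∑ j ∈ Finset.univ.erase k, ((s j : ℕ) : ZMod p) * ((e j : ZMod p) - e' j) =
        ∑ j ∈ Finset.univ.erase k, ((t j : ℕ) : ZMod p) * ((e j : ZMod p) - e' j) :=
      Finset.sum_congr rfl fun j hj => by rw [hoff j (Finset.ne_of_mem_erase hj)]
    rw [hsum] at h1
    have hne : (e k : ZMod p) - e' k ≠ 0 := fun h =>
      hk ((ZMod.natCast_eq_natCast_iff _ _ _).1 (sub_eq_zero.1 h))
    have hcast := mul_right_cancel₀ hne (add_right_cancel (h1.trans h2.symm))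
    have hmod := (ZMod.natCast_eq_natCast_iff _ _ _).1 hcast
    funext j
    by_cases hj : j = k
    · subst hj
      exact Fin.ext (Nat.ModEq.eq_of_lt_of_lt hmod (s j).2 (t j).2)
    · exact hoff j hj
  have hn : n - 1 + 1 = n := Nat.sub_add_cancel (Nat.one_le_of_lt k.2)
  calc _ ≤ p * p ^ (n - 1) := by
        gcongr
        simpa [Fintype.card_subtype_compl] using hcard
    _ = p ^ n := by rw [← pow_succ', hn]

/-- A positive integer `d ≤ D` has at most `log₂ D` distinct prime divisors. -/
lemma card_filter_prime_dvd_le_log {ι : Type*} [Fintype ι] (p : ι → ℕ)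
    (hprime : ∀ i, (p i).Prime) (hinj : Function.Injective p) {d D : ℕ} (hd : d ≠ 0)
    (hdD : d ≤ D) : (Finset.univ.filter (fun i => p i ∣ d)).card ≤ Nat.log 2 D := by
  refine Nat.le_log_of_pow_le one_lt_two ?_
  calc 2 ^ (Finset.univ.filter (fun i => p i ∣ d)).card
      ≤ ∏ i ∈ Finset.univ.filter (fun i => p i ∣ d), p i :=
        Finset.pow_card_le_prod _ _ _ fun i _ => (hprime i).two_le
    _ ≤ d := Nat.le_of_dvd (Nat.pos_of_ne_zero hd) <|
        Finset.prod_dvd_of_isRelPrime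
          (fun i _ j _ hij =>
            Nat.coprime_iff_isRelPrime.1 <|
              (Nat.coprime_primes (hprime i) (hprime j)).2 (hinj.ne hij))
          (fun i hi => (Finset.mem_filter.1 hi).2)
    _ ≤ D := hdD

/-- Two distinct exponent vectors with entries at most `D` agree modulo at most `log₂ D` of
finitely many distinct primes. -/
lemma card_filter_forall_modEq_le_log {ι : Type*} [Fintype ι] {n : ℕ} (p : ι → ℕ)
    (hprime : ∀ i, (p i).Prime) (hinj : Function.Injective p) {D : ℕ} {e e' : Fin n →₀ ℕ}
    (hne : e' ≠ e) (he : ∀ k, e k ≤ D) (he' : ∀ k, e' k ≤ D) :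
    (Finset.univ.filter (fun i => ∀ k, e k ≡ e' k [MOD p i])).card ≤ Nat.log 2 D := by
  obtain ⟨k, hk⟩ : ∃ k, e' k ≠ e k := by
    by_contra! h
    exact hne (Finsupp.ext h)
  have hd : ((e' k : ℤ) - e k).natAbs ≠ 0 := by omega
  have hdD : ((e' k : ℤ) - e k).natAbs ≤ D := by
    have := he k
    have := he' k
    omega
  refine le_trans (Finset.card_le_card ?_) (card_filter_prime_dvd_le_log p hprime hinj hd hdD)
  intro i hi
  simp only [Finset.mem_filter, Finset.mem_univ, true_and] at hi ⊢
  exact Int.natCast_dvd.1 (Nat.modEq_iff_dvd.1 (hi k))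

/-- If no other exponent of `f` agrees with `e` modulo `p`, then the term with exponent `e`
collides for at most a fraction `(#f - 1) / p` of all substitution vectors. -/
lemma mul_card_collides_le {R : Type*} [CommRing R] {n p : ℕ} (hp : p.Prime)
    (f : MvPolynomial (Fin n) R) (e : Fin n →₀ ℕ)
    (hgood : ∀ e' ∈ f.support.erase e, ∃ k, ¬ e k ≡ e' k [MOD p]) :
    p * (Finset.univ.filter (fun s : Fin n → Fin p =>
      Collides f p (fun k => (s k : ℕ)) e)).card ≤ (f.support.erase e).card * p ^ n := by
  have hsub : Finset.univ.filter (fun s : Fin n → Fin p =>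
      Collides f p (fun k => (s k : ℕ)) e) ⊆
      (f.support.erase e).biUnion fun e' => Finset.univ.filter (fun s : Fin n → Fin p =>
        dotProd (fun k => (s k : ℕ)) e ≡ dotProd (fun k => (s k : ℕ)) e' [MOD p]) := by
    intro s hs
    obtain ⟨e', he', hne, h⟩ := (Finset.mem_filter.1 hs).2
    exact Finset.mem_biUnion.2 ⟨e', Finset.mem_erase.2 ⟨hne, he'⟩,
      Finset.mem_filter.2 ⟨Finset.mem_univ _, h⟩⟩
  calc _ ≤ p * ∑ e' ∈ f.support.erase e, _ :=
        Nat.mul_le_mul_left _ ((Finset.card_le_card hsub).trans Finset.card_biUnion_le)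
    _ = ∑ e' ∈ f.support.erase e, _ := Finset.mul_sum _ _ _
    _ ≤ ∑ _e' ∈ f.support.erase e, p ^ n := Finset.sum_le_sum fun e' he' => by
        obtain ⟨k, hk⟩ := hgood e' he'
        exact mul_card_dotProd_modEq_le hp e e' k hk
    _ = _ := by rw [Finset.sum_const, smul_eq_mul]

/-- Among finitely many distinct primes, at most `(#f - 1) log₂ D` are such that the exponent `e`
agrees with another exponent of `f` modulo that prime, where `D ≥ deg f`. -/
lemma card_filter_exists_modEq_le {R : Type*} [CommRing R] {ι : Type*} [Fintype ι] {n : ℕ}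
    (p : ι → ℕ) (hprime : ∀ i, (p i).Prime) (hinj : Function.Injective p)
    (f : MvPolynomial (Fin n) R) {D : ℕ} (hD : f.totalDegree ≤ D)
    {e : Fin n →₀ ℕ} (he : e ∈ f.support) :
    (Finset.univ.filter (fun i => ∃ e' ∈ f.support.erase e, ∀ k, e k ≡ e' k [MOD p i])).card ≤
      (f.support.erase e).card * Nat.log 2 D := by
  have hdeg : ∀ e' ∈ f.support, ∀ k, e' k ≤ D := fun e' he' k =>
    (MvPolynomial.le_degreeOf_of_mem_support k he').trans
      ((MvPolynomial.degreeOf_le_totalDegree f k).trans hD)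
  have hsub : Finset.univ.filter (fun i => ∃ e' ∈ f.support.erase e,
      ∀ k, e k ≡ e' k [MOD p i]) ⊆ (f.support.erase e).biUnion fun e' =>
        Finset.univ.filter (fun i => ∀ k, e k ≡ e' k [MOD p i]) := by
    intro i hi
    obtain ⟨e', he', h⟩ := (Finset.mem_filter.1 hi).2
    exact Finset.mem_biUnion.2 ⟨e', he', Finset.mem_filter.2 ⟨Finset.mem_univ _, h⟩⟩
  refine (Finset.card_le_card hsub).trans (Finset.card_biUnion_le_card_mul _ _ _ ?_)
  intro e' he'
  obtain ⟨hne, hmem⟩ := Finset.mem_erase.1 he'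
  exact card_filter_forall_modEq_le_log p hprime hinj hne (hdeg e he) (hdeg e' hmem)

theorem collision_probability_le {R : Type*} [CommRing R] {n : ℕ}
    (f : MvPolynomial (Fin n) R) (hf : f ≠ 0)
    (T D : ℕ) (hT : f.support.card ≤ T) (hD : f.totalDegree ≤ D)
    (N : ℕ) (hN : N = max (31 * ⌊((T : ℝ) - 1) * Real.logb 2 D⌋₊) 1)
    (p : Fin N → ℕ) (hprime : ∀ i, (p i).Prime)
    (hdist : Function.Injective p)
    (hbig : ∀ i, 32 * (T - 1) ≤ p i)
    (e0 : Fin n →₀ ℕ) (he0 : e0 ∈ f.support) :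
    ∑ i : Fin N,
      (((Finset.univ.filter (fun s : Fin n → Fin (p i) =>
          Collides f (p i) (fun k => (s k : ℕ)) e0)).card : ℝ) / (p i : ℝ) ^ n)
      ≤ (N : ℝ) / 16 := by
  have hT' : (f.support.erase e0).card ≤ T - 1 := by
    rw [Finset.card_erase_of_mem he0]
    omega
  have hT1 : 1 ≤ T := (Finset.card_pos.2 ⟨e0, he0⟩).trans_le hT
  set B := Finset.univ.filter
    (fun i => ∃ e' ∈ f.support.erase e0, ∀ k, e0 k ≡ e' k [MOD p i]) with hB
  have hBcard : B.card ≤ ⌊((T : ℝ) - 1) * Real.logb 2 D⌋₊ := by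
    refine Nat.le_floor ?_
    have h1 : B.card ≤ (T - 1) * Nat.log 2 D :=
      (card_filter_exists_modEq_le p hprime hdist f hD he0).trans
        (Nat.mul_le_mul_right _ hT')
    have h2 : (Nat.log 2 D : ℝ) ≤ Real.logb 2 D := by
      simpa using Real.natLog_le_logb D 2
    calc (B.card : ℝ) ≤ ((T - 1 : ℕ) : ℝ) * (Nat.log 2 D : ℝ) := by exact_mod_cast h1
      _ ≤ ((T - 1 : ℕ) : ℝ) * Real.logb 2 D := by gcongr
      _ = _ := by rw [Nat.cast_sub hT1, Nat.cast_one]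
  have hterm : ∀ i, (((Finset.univ.filter (fun s : Fin n → Fin (p i) =>
      Collides f (p i) (fun k => (s k : ℕ)) e0)).card : ℝ) / (p i : ℝ) ^ n) ≤
      1 / 32 + if i ∈ B then 31 / 32 else 0 := by
    intro i
    have hpos : (0 : ℝ) < (p i : ℝ) ^ n := pow_pos (Nat.cast_pos.2 (hprime i).pos) n
    rw [div_le_iff₀ hpos]
    split_ifs with hi
    · have h : (Finset.univ.filter (fun s : Fin n → Fin (p i) =>
          Collides f (p i) (fun k => (s k : ℕ)) e0)).card ≤ p i ^ n := by
        simpa using Finset.card_le_univ (Finset.univ.filter (fun s : Fin n → Fin (p i) =>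
          Collides f (p i) (fun k => (s k : ℕ)) e0))
      have h' : ((Finset.univ.filter (fun s : Fin n → Fin (p i) =>
          Collides f (p i) (fun k => (s k : ℕ)) e0)).card : ℝ) ≤ (p i : ℝ) ^ n := by
        exact_mod_cast h
      linarith
    · have hgood : ∀ e' ∈ f.support.erase e0, ∃ k, ¬ e0 k ≡ e' k [MOD p i] := by
        simpa only [hB, Finset.mem_filter, Finset.mem_univ, true_and, not_exists, not_and,
          not_forall] using hi
      have h : 32 * (Finset.univ.filter (fun s : Fin n → Fin (p i) =>
          Collides f (p i) (fun k => (s k : ℕ)) e0)).card ≤ p i ^ n := by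
        refine Nat.le_of_mul_le_mul_left ?_ (hprime i).pos
        calc _ = 32 * (p i * _) := Nat.mul_left_comm _ _ _
          _ ≤ 32 * ((f.support.erase e0).card * p i ^ n) :=
            Nat.mul_le_mul_left _ (mul_card_collides_le (hprime i) f e0 hgood)
          _ ≤ 32 * ((T - 1) * p i ^ n) := by gcongr
          _ = 32 * (T - 1) * p i ^ n := (mul_assoc _ _ _).symm
          _ ≤ p i * p i ^ n := Nat.mul_le_mul_right _ (hbig i)
      have h' : 32 * ((Finset.univ.filter (fun s : Fin n → Fin (p i) =>
          Collides f (p i) (fun k => (s k : ℕ)) e0)).card : ℝ) ≤ (p i : ℝ) ^ n := by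
        exact_mod_cast h
      linarith
  have hBN : 31 * B.card ≤ N := by
    exact ((Nat.mul_le_mul_left 31 hBcard).trans (le_max_left _ 1)).trans_eq hN.symm
  have hBN' : 31 * (B.card : ℝ) ≤ N := by exact_mod_cast hBN
  calc _ ≤ ∑ i : Fin N, ((1 : ℝ) / 32 + if i ∈ B then 31 / 32 else 0) :=
        Finset.sum_le_sum fun i _ => hterm i
    _ = N / 32 + B.card * (31 / 32) := by
        rw [Finset.sum_add_distrib, Finset.sum_ite_mem, Finset.univ_inter]
        simp [div_eq_mul_inv]
    _ ≤ N / 16 := by linarith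

end
end

section
/- Let f ∈ R[x_1,…,x_n] be nonzero, T ≥ #f, D ≥ deg f, N = max{31·⌈(T−1)·log₂ D⌉, 1}, and let p_1,…,p_N be N distinct primes with p_i ≥ 32(T−1). Let μ ∈ (0,1) and let l ≥ ⌈32·ln(T·μ^{−1})⌉. For i = 1,…,l, independently choose a prime p_{α_i} uniformly at random from {p_1,…,p_N} and then choose s_i uniformly at random from Z_{p_{α_i}}^n. Then with probability at least 1 − μ the following holds: for every index j0 ∈ {1,…,l} at which #(f^mod_(p_{α_{j0}})(x^{s_{j0}})) is maximal among i = 1,…,l, at least (5/8)·#f of the terms of f do not collide in f^mod_(p_{α_{j0}})(x^{s_{j0}}). -/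
open scoped Classical

noncomputable section

theorem two_mul_card_support_kronMod_add_numCollide_le {R : Type*} [CommRing R] {n : ℕ}
    {p : ℕ} (hp : 0 < p) (s : Fin n → ℕ) (f : MvPolynomial (Fin n) R) :
    2 * (kronMod p s f).support.card + numCollide f p s ≤ 2 * f.support.card := by
  have hsub : (kronMod p s f).support ⊆ f.support.image (fun e => dotProd s e % p) := by
    intro m hm
    by_contra hm'
    refine Polynomial.mem_support_iff.mp hm ?_
    rw [kronMod_eq_sum hp, Polynomial.finsetSum_coeff]
    refine Finset.sum_eq_zero fun e he => ?_
    rw [Polynomial.coeff_monomial, if_neg]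
    exact fun h => hm' (Finset.mem_image.mpr ⟨e, he, h⟩)
  have hsplit := Finset.card_filter_add_card_filter_not (s := f.support)
    (fun e => Collides f p s e)
  have hunion : f.support.image (fun e => dotProd s e % p) =
      (f.support.filter (fun e => Collides f p s e)).image (fun e => dotProd s e % p) ∪
      (f.support.filter (fun e => ¬ Collides f p s e)).image (fun e => dotProd s e % p) := by
    rw [← Finset.image_union, Finset.filter_union_filter_not_eq]
  have hcoll := Finset.mul_card_image_le_card (f := fun e => dotProd s e % p)
    (f.support.filter (fun e => Collides f p s e)) 2 (by
      intro b hb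
      obtain ⟨e, he, rfl⟩ := Finset.mem_image.mp hb
      obtain ⟨hes, e', he', hne, hmod⟩ := Finset.mem_filter.mp he
      refine Finset.one_lt_card.mpr ⟨e, ?_, e', ?_, hne.symm⟩
      · exact Finset.mem_filter.mpr ⟨he, rfl⟩
      · exact Finset.mem_filter.mpr
          ⟨Finset.mem_filter.mpr ⟨he', e, hes, hne.symm, hmod.symm⟩, hmod.symm⟩)
  have hfree := Finset.card_image_le (f := fun e => dotProd s e % p)
    (s := f.support.filter (fun e => ¬ Collides f p s e))
  have hcard := Finset.card_le_card hsub
  rw [hunion] at hcard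
  have hcard' := hcard.trans (Finset.card_union_le _ _)
  unfold numCollide
  omega

theorem card_filter_not_collides_le_card_support_kronMod {R : Type*} [CommRing R] {n : ℕ}
    {p : ℕ} (hp : 0 < p) (s : Fin n → ℕ) (f : MvPolynomial (Fin n) R) :
    (f.support.filter (fun e => ¬ Collides f p s e)).card ≤ (kronMod p s f).support.card := by
  refine Finset.card_le_card_of_injOn (fun e => dotProd s e % p) ?_ ?_
  · intro e he
    obtain ⟨hes, hnc⟩ := Finset.mem_filter.mp he
    rw [Finset.mem_coe, Polynomial.mem_support_iff, kronMod_eq_sum hp,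
      Polynomial.finsetSum_coeff, Finset.sum_eq_single_of_mem e hes]
    · rw [Polynomial.coeff_monomial_same]
      exact MvPolynomial.mem_support_iff.mp hes
    · intro e' he' hne
      rw [Polynomial.coeff_monomial, if_neg]
      exact fun h => hnc ⟨e', he', hne, h.symm⟩
  · intro e he e' he' h
    by_contra hne
    exact (Finset.mem_filter.mp he).2 ⟨e', (Finset.mem_filter.mp he').1, Ne.symm hne, h⟩

theorem card_filter_dotProduct_eq_zero_mul_card_le {n : ℕ} {K : Type*} [Field K] [Fintype K]
    {d : Fin n → K} {k : Fin n} (hk : d k ≠ 0) :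
    (Finset.univ.filter (fun s : Fin n → K => s ⬝ᵥ d = 0)).card * Fintype.card K ≤
      Fintype.card K ^ n := by
  have h := Finset.card_le_card_of_injOn
    (s := Finset.univ.filter (fun s : Fin n → K => s ⬝ᵥ d = 0) ×ˢ (Finset.univ : Finset K))
    (t := (Finset.univ : Finset (Fin n → K)))
    (fun x => x.1 + Pi.single k x.2) (fun _ _ => Finset.mem_coe.mpr (Finset.mem_univ _)) (by
      rintro ⟨s, a⟩ hs ⟨s', a'⟩ hs' h
      simp only [Finset.coe_product, Set.mem_prod, Finset.mem_coe, Finset.mem_filter,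
        Finset.mem_univ, true_and, and_true] at hs hs' h
      have ha := congrArg (· ⬝ᵥ d) h
      simp only [add_dotProduct, hs, hs', single_dotProduct, zero_add] at ha
      obtain rfl := mul_right_cancel₀ hk ha
      exact Prod.ext (add_right_cancel h) rfl)
  simpa [Finset.card_product] using h

theorem card_filter_dotProd_modEq_mul_le {n p : ℕ} (hp : p.Prime) {e e' : Fin n →₀ ℕ}
    {k : Fin n} (hk : ¬ e k ≡ e' k [MOD p]) :
    (Finset.univ.filter (fun s : Fin n → Fin p =>
      dotProd (fun k => (s k : ℕ)) e ≡ dotProd (fun k => (s k : ℕ)) e' [MOD p])).card * p ≤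
      p ^ n := by
  have := Fact.mk hp
  have hd : (fun i => (e i : ZMod p) - (e' i : ZMod p)) k ≠ 0 := by
    rw [← ZMod.natCast_eq_natCast_iff] at hk
    exact sub_ne_zero.mpr hk
  have h := card_filter_dotProduct_eq_zero_mul_card_le
    (d := fun i => (e i : ZMod p) - (e' i : ZMod p)) hd
  rw [ZMod.card] at h
  refine (Nat.mul_le_mul_right p ?_).trans h
  refine Finset.card_le_card_of_injOn (fun s i => ((s i : ℕ) : ZMod p)) ?_ ?_
  · intro s hs
    have hs' := (ZMod.natCast_eq_natCast_iff _ _ _).mpr (Finset.mem_filter.mp hs).2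
    simp only [dotProd, Nat.cast_sum, Nat.cast_mul] at hs'
    simp only [Finset.coe_filter, Finset.mem_univ, true_and, Set.mem_ofPred_eq, dotProduct,
      mul_sub, Finset.sum_sub_distrib]
    exact sub_eq_zero.mpr hs'
  · intro s _ s' _ h
    funext i
    have hi := (ZMod.natCast_eq_natCast_iff _ _ _).mp (congrFun h i)
    exact Fin.ext (hi.eq_of_lt_of_lt (s i).isLt (s' i).isLt)

theorem two_pow_card_filter_forall_modEq_le {n D : ℕ} {ι : Type*} [Fintype ι] {p : ι → ℕ}
    (hprime : ∀ i, (p i).Prime) (hinj : Function.Injective p) {e e' : Fin n →₀ ℕ}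
    (hne : e ≠ e') (he : ∀ k, e k ≤ D) (he' : ∀ k, e' k ≤ D) :
    2 ^ (Finset.univ.filter (fun i => ∀ k, e k ≡ e' k [MOD p i])).card ≤ D := by
  obtain ⟨k, hk⟩ := Finsupp.ne_iff.mp hne
  set S := Finset.univ.filter (fun i => ∀ k, e k ≡ e' k [MOD p i])
  have hdvd : ∏ q ∈ S.image p, q ∣ ((e' k : ℤ) - e k).natAbs := by
    refine Finset.prod_primes_dvd _ ?_ ?_
    · intro q hq
      obtain ⟨i, _, rfl⟩ := Finset.mem_image.mp hq
      exact (hprime i).prime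
    · intro q hq
      obtain ⟨i, hi, rfl⟩ := Finset.mem_image.mp hq
      exact Int.natCast_dvd.mp (Nat.modEq_iff_dvd.mp ((Finset.mem_filter.mp hi).2 k))
  rw [Finset.prod_image hinj.injOn] at hdvd
  have h1 := he k
  have h2 := he' k
  calc 2 ^ S.card ≤ ∏ i ∈ S, p i := Finset.pow_card_le_prod _ _ _ fun i _ => (hprime i).two_le
    _ ≤ ((e' k : ℤ) - e k).natAbs := Nat.le_of_dvd (by omega) hdvd
    _ ≤ D := by omega

theorem card_filter_exists_forall_modEq_le {n D : ℕ} {ι : Type*} [Fintype ι] {p : ι → ℕ}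
    (hprime : ∀ i, (p i).Prime) (hinj : Function.Injective p) {A : Finset (Fin n →₀ ℕ)}
    (hA : ∀ e ∈ A, ∀ k, e k ≤ D) {e : Fin n →₀ ℕ} (he : e ∈ A) :
    ((Finset.univ.filter (fun i => ∃ e' ∈ A, e' ≠ e ∧ ∀ k, e k ≡ e' k [MOD p i])).card : ℝ) ≤
      ((A.card : ℝ) - 1) * Real.logb 2 D := by
  have hsub : Finset.univ.filter (fun i => ∃ e' ∈ A, e' ≠ e ∧ ∀ k, e k ≡ e' k [MOD p i]) ⊆
      (A.erase e).biUnion fun e' => Finset.univ.filter (fun i => ∀ k, e k ≡ e' k [MOD p i]) := by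
    intro i hi
    obtain ⟨e', he', hne, hmod⟩ := (Finset.mem_filter.mp hi).2
    simp only [Finset.mem_biUnion, Finset.mem_erase, Finset.mem_filter, Finset.mem_univ, true_and]
    exact ⟨e', ⟨hne, he'⟩, hmod⟩
  have hle := (Finset.card_le_card hsub).trans Finset.card_biUnion_le
  calc _ ≤ ∑ e' ∈ A.erase e,
        ((Finset.univ.filter (fun i => ∀ k, e k ≡ e' k [MOD p i])).card : ℝ) := by
        exact_mod_cast hle
    _ ≤ ∑ e' ∈ A.erase e, Real.logb 2 D := by
        refine Finset.sum_le_sum fun e' he' => ?_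
        obtain ⟨hne, heA⟩ := Finset.mem_erase.mp he'
        have hpow := two_pow_card_filter_forall_modEq_le hprime hinj hne.symm (hA e he) (hA e' heA)
        have hD : 0 < D := lt_of_lt_of_le (by positivity) hpow
        rw [Real.le_logb_iff_rpow_le one_lt_two (by exact_mod_cast hD), Real.rpow_natCast]
        exact_mod_cast hpow
    _ = ((A.card : ℝ) - 1) * Real.logb 2 D := by
        rw [Finset.sum_const, nsmul_eq_mul, Finset.cast_card_erase_of_mem he]

theorem card_filter_collides_mul_le {R : Type*} [CommRing R] {n : ℕ}
    {f : MvPolynomial (Fin n) R} {p : ℕ} (hp : p.Prime) {e : Fin n →₀ ℕ} (he : e ∈ f.support)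
    (hgood : ¬ ∃ e' ∈ f.support, e' ≠ e ∧ ∀ k, e k ≡ e' k [MOD p]) :
    (Finset.univ.filter (fun s : Fin n → Fin p =>
      Collides f p (fun k => (s k : ℕ)) e)).card * p ≤ (f.support.card - 1) * p ^ n := by
  have hsub : Finset.univ.filter (fun s : Fin n → Fin p =>
      Collides f p (fun k => (s k : ℕ)) e) ⊆
      (f.support.erase e).biUnion fun e' => Finset.univ.filter (fun s : Fin n → Fin p =>
        dotProd (fun k => (s k : ℕ)) e ≡ dotProd (fun k => (s k : ℕ)) e' [MOD p]) := by
    intro s hs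
    obtain ⟨e', he', hne, hmod⟩ := (Finset.mem_filter.mp hs).2
    exact Finset.mem_biUnion.mpr ⟨e', Finset.mem_erase.mpr ⟨hne, he'⟩,
      Finset.mem_filter.mpr ⟨Finset.mem_univ _, hmod⟩⟩
  refine (Nat.mul_le_mul_right p ((Finset.card_le_card hsub).trans
    Finset.card_biUnion_le)).trans ?_
  rw [Finset.sum_mul, ← Finset.card_erase_of_mem he, ← smul_eq_mul]
  refine Finset.sum_le_card_nsmul _ _ _ fun e' he' => ?_
  obtain ⟨hne, he'⟩ := Finset.mem_erase.mp he'
  push Not at hgood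
  obtain ⟨k, hk⟩ := hgood e' he' hne
  exact card_filter_dotProd_modEq_mul_le hp hk

theorem sum_filter_collides_le {R : Type*} [CommRing R] {n : ℕ}
    {f : MvPolynomial (Fin n) R} {D N : ℕ} (hD : f.totalDegree ≤ D) (hN : 0 < N)
    (hNlog : 31 * (((f.support.card : ℝ) - 1) * Real.logb 2 D) ≤ N)
    {p : Fin N → ℕ} (hprime : ∀ i, (p i).Prime) (hinj : Function.Injective p)
    (hbig : ∀ i, 32 * (f.support.card - 1) ≤ p i) {e : Fin n →₀ ℕ} (he : e ∈ f.support) :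
    ∑ x ∈ Finset.univ.filter (fun x : Σ i : Fin N, (Fin n → Fin (p i)) =>
        Collides f (p x.1) (fun k => (x.2 k : ℕ)) e),
      (1 : ℝ) / ((N : ℝ) * (p x.1 : ℝ) ^ n) ≤ 1 / 16 := by
  have hle : ∀ e ∈ f.support, ∀ k, e k ≤ D := by
    intro e he k
    refine le_trans ?_ ((MvPolynomial.le_totalDegree he).trans hD)
    rw [Finsupp.sum_fintype _ _ fun _ => rfl]
    exact Finset.single_le_sum (f := fun i => e i) (fun _ _ => Nat.zero_le _) (Finset.mem_univ k)
  have hbad := card_filter_exists_forall_modEq_le hprime hinj hle he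
  have hN' : (0 : ℝ) < N := by exact_mod_cast hN
  rw [Finset.sum_filter, Fintype.sum_sigma]
  have hfiber : ∀ i : Fin N, (∑ s : Fin n → Fin (p i),
      if Collides f (p i) (fun k => (s k : ℕ)) e then (1 : ℝ) / ((N : ℝ) * (p i : ℝ) ^ n) else 0) ≤
      (1 / N) * (1 / 32 + 31 / 32 *
        if ∃ e' ∈ f.support, e' ≠ e ∧ ∀ k, e k ≡ e' k [MOD p i] then 1 else 0) := by
    intro i
    have hpi : (0 : ℝ) < p i := by exact_mod_cast (hprime i).pos
    rw [← Finset.sum_filter, Finset.sum_const, nsmul_eq_mul, ← div_div, mul_div_left_comm]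
    refine mul_le_mul_of_nonneg_left ?_ (by positivity)
    rw [div_le_iff₀ (by positivity)]
    split_ifs with hex
    · have hcard := Finset.card_filter_le (Finset.univ : Finset (Fin n → Fin (p i)))
        (fun s => Collides f (p i) (fun k => (s k : ℕ)) e)
      simp only [Finset.card_univ, Fintype.card_pi, Fintype.card_fin, Finset.prod_const] at hcard
      have hcard' : ((Finset.univ.filter (fun s : Fin n → Fin (p i) =>
          Collides f (p i) (fun k => (s k : ℕ)) e)).card : ℝ) ≤ (p i : ℝ) ^ n := by
        exact_mod_cast hcard
      linarith
    · have hcard := Nat.mul_le_mul_left 32 (card_filter_collides_mul_le (hprime i) he hex)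
      rw [← mul_assoc, ← mul_assoc] at hcard
      have hcard' := hcard.trans (Nat.mul_le_mul_right (p i ^ n) (hbig i))
      rw [mul_comm (p i)] at hcard'
      have hmul := Nat.le_of_mul_le_mul_right hcard' (hprime i).pos
      have hmul' : 32 * ((Finset.univ.filter (fun s : Fin n → Fin (p i) =>
          Collides f (p i) (fun k => (s k : ℕ)) e)).card : ℝ) ≤ (p i : ℝ) ^ n := by
        exact_mod_cast hmul
      linarith
  refine (Finset.sum_le_sum fun i _ => hfiber i).trans ?_
  rw [← Finset.mul_sum, Finset.sum_add_distrib, ← Finset.mul_sum, Finset.sum_boole,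
    Finset.sum_const, Finset.card_univ, Fintype.card_fin, nsmul_eq_mul, one_div_mul_eq_div,
    div_le_iff₀ hN']
  linarith

theorem one_sub_pow_le_sum_filter {Ω : Type*} [Fintype Ω] {w : Ω → ℝ} (hw : ∀ x, 0 ≤ w x)
    (hsum : ∑ x, w x = 1) {l : ℕ} (P : (Fin l → Ω) → Prop)
    [DecidablePred P] (B : Finset Ω)
    (hB : ∀ ω, ¬ P ω → ∀ j, ω j ∈ B) :
    1 - (∑ x ∈ B, w x) ^ l ≤ ∑ ω ∈ Finset.univ.filter P, ∏ j, w (ω j) := by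
  have htotal : ∑ ω : Fin l → Ω, ∏ j, w (ω j) = 1 := by
    rw [← Fintype.piFinset_univ, Finset.sum_prod_piFinset Finset.univ fun _ => w]
    simp [hsum]
  have hBpow : (∑ x ∈ B, w x) ^ l =
      ∑ ω ∈ Fintype.piFinset fun _ : Fin l => B, ∏ j, w (ω j) := by
    rw [Finset.sum_prod_piFinset B fun _ => w]
    simp
  have hle : ∑ ω ∈ Finset.univ.filter (fun ω => ¬ P ω), ∏ j, w (ω j) ≤
      ∑ ω ∈ Fintype.piFinset fun _ : Fin l => B, ∏ j, w (ω j) := by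
    refine Finset.sum_le_sum_of_subset_of_nonneg (fun ω hω => ?_)
      fun ω _ _ => Finset.prod_nonneg fun j _ => hw _
    exact Fintype.mem_piFinset.mpr (hB ω (Finset.mem_filter.mp hω).2)
  have hsplit := Finset.sum_filter_add_sum_filter_not Finset.univ P
    (fun ω : Fin l → Ω => ∏ j, w (ω j))
  rw [hBpow]
  linarith

theorem mul_sum_filter_lt_le {Ω : Type*} [Fintype Ω] {w C : Ω → ℝ} (hw : ∀ x, 0 ≤ w x)
    (hC : ∀ x, 0 ≤ C x) (c : ℝ) :
    c * ∑ x ∈ Finset.univ.filter (fun x => c < C x), w x ≤ ∑ x, w x * C x := by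
  rw [Finset.mul_sum]
  calc _ ≤ ∑ x ∈ Finset.univ.filter (fun x => c < C x), w x * C x := by
        refine Finset.sum_le_sum fun x hx => ?_
        rw [mul_comm]
        exact mul_le_mul_of_nonneg_left (Finset.mem_filter.mp hx).2.le (hw x)
    _ ≤ _ := Finset.sum_le_sum_of_subset_of_nonneg (Finset.filter_subset _ _)
        fun x _ _ => mul_nonneg (hw x) (hC x)

theorem one_third_pow_le {μ : ℝ} (hμ0 : 0 < μ) (hμ1 : μ < 1) {l : ℕ}
    (hl : 32 * Real.log μ⁻¹ ≤ l) : (1 / 3 : ℝ) ^ l ≤ μ := by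
  have hlog : 0 ≤ Real.log μ⁻¹ := Real.log_nonneg ((one_le_inv₀ hμ0).mpr hμ1.le)
  have hbase : (1 / 3 : ℝ) ≤ Real.exp (-1) := by
    rw [Real.exp_neg, one_div]
    exact inv_anti₀ (Real.exp_pos 1) (by linarith [Real.exp_one_lt_d9])
  calc (1 / 3 : ℝ) ^ l ≤ Real.exp (-1) ^ l := by gcongr
    _ = Real.exp (-l) := by rw [← Real.exp_nat_mul]; ring_nf
    _ ≤ Real.exp (Real.log μ) := by
        rw [Real.log_inv] at hl hlog
        exact Real.exp_le_exp.mpr (by linarith)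
    _ = μ := Real.exp_log hμ0

theorem sum_one_div_mul_pow_eq_one {n N : ℕ} (hN : 0 < N) {p : Fin N → ℕ}
    (hp : ∀ i, 0 < p i) :
    ∑ x : Σ i : Fin N, (Fin n → Fin (p i)), (1 : ℝ) / ((N : ℝ) * (p x.1 : ℝ) ^ n) = 1 := by
  have hN' : (N : ℝ) ≠ 0 := by exact_mod_cast hN.ne'
  have hfiber : ∀ i : Fin N,
      ∑ _s : Fin n → Fin (p i), (1 : ℝ) / ((N : ℝ) * (p i : ℝ) ^ n) = 1 / N := by
    intro i
    have hpi : (p i : ℝ) ≠ 0 := by exact_mod_cast (hp i).ne'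
    simp only [Finset.sum_const, Finset.card_univ, Fintype.card_pi, Fintype.card_fin,
      Finset.prod_const, nsmul_eq_mul, Nat.cast_pow]
    field_simp
  rw [Fintype.sum_sigma]
  simp only [hfiber, Finset.sum_const, Finset.card_univ, Fintype.card_fin, nsmul_eq_mul]
  field_simp

/-- Theorem: with probability at least `1 - μ` over `l` independent choices of a
uniformly random prime `p_{α_i}` among `p_1, …, p_N` followed by a uniformly random
`s_i ∈ Z_{p_{α_i}}^n`, every index `j0` maximizing `#(f^mod_(p_{α_{j0}})(x^{s_{j0}}))`
is such that at least `(5/8)·#f` of the terms of `f` do not collide in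
`f^mod_(p_{α_{j0}})(x^{s_{j0}})`.  Each outcome `ω : Fin l → Σ i, (Fin n → Fin (p i))`
has probability `∏_j 1/(N · (p (ω j).1)^n)`. -/
theorem max_terms_substitution_is_ok {R : Type*} [CommRing R] {n : ℕ}
    (f : MvPolynomial (Fin n) R) (hf : f ≠ 0)
    (T D : ℕ) (hT : f.support.card ≤ T) (hD : f.totalDegree ≤ D)
    (N : ℕ) (hN : N = max (31 * ⌈((T : ℝ) - 1) * Real.logb 2 D⌉₊) 1)
    (p : Fin N → ℕ) (hprime : ∀ i, (p i).Prime)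
    (hdist : Function.Injective p)
    (hbig : ∀ i, 32 * (T - 1) ≤ p i)
    (μ : ℝ) (hμ0 : 0 < μ) (hμ1 : μ < 1)
    (l : ℕ) (hl : ⌈(32 : ℝ) * Real.log ((T : ℝ) * μ⁻¹)⌉₊ ≤ l) :
    1 - μ ≤
      ∑ ω ∈ (Finset.univ.filter
        (fun ω : Fin l → Σ i : Fin N, (Fin n → Fin (p i)) =>
          ∀ j0 : Fin l,
            (∀ j : Fin l,
              (kronMod (p (ω j).1) (fun k => ((ω j).2 k : ℕ)) f).support.card ≤
              (kronMod (p (ω j0).1) (fun k => ((ω j0).2 k : ℕ)) f).support.card) →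
            (5 / 8 : ℝ) * (f.support.card : ℝ) ≤
              ((f.support.filter (fun e =>
                ¬ Collides f (p (ω j0).1) (fun k => ((ω j0).2 k : ℕ)) e)).card : ℝ))),
        ∏ j : Fin l, (1 : ℝ) / ((N : ℝ) * (p (ω j).1 : ℝ) ^ n) := by
  have hcard : 0 < f.support.card := Finset.card_pos.mpr (MvPolynomial.support_nonempty.mpr hf)
  have hcardR : (0 : ℝ) < f.support.card := by exact_mod_cast hcard
  have hTR : (f.support.card : ℝ) ≤ T := by exact_mod_cast hT
  have hT1 : (1 : ℝ) ≤ T := by exact_mod_cast hcard.trans_le hT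
  have hNpos : 0 < N := by omega
  have hlogD : 0 ≤ Real.logb 2 D := by
    rcases Nat.eq_zero_or_pos D with rfl | hD0
    · simp
    · exact Real.logb_nonneg one_lt_two (by exact_mod_cast hD0)
  have hNlog : 31 * (((f.support.card : ℝ) - 1) * Real.logb 2 D) ≤ N := by
    have h1 : ((31 * ⌈((T : ℝ) - 1) * Real.logb 2 D⌉₊ : ℕ) : ℝ) ≤ N := by
      exact_mod_cast hN ▸ le_max_left _ _
    have h2 := Nat.le_ceil (((T : ℝ) - 1) * Real.logb 2 D)
    have h3 : ((f.support.card : ℝ) - 1) * Real.logb 2 D ≤ ((T : ℝ) - 1) * Real.logb 2 D := by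
      gcongr
    push_cast at h1
    linarith
  have hlμ : 32 * Real.log μ⁻¹ ≤ l := by
    have h1 := (Nat.ceil_le.mp hl)
    have h2 : Real.log μ⁻¹ ≤ Real.log ((T : ℝ) * μ⁻¹) :=
      Real.log_le_log (inv_pos.mpr hμ0) (le_mul_of_one_le_left (inv_pos.mpr hμ0).le hT1)
    linarith
  set C : (Σ i : Fin N, (Fin n → Fin (p i))) → ℝ :=
    fun x => numCollide f (p x.1) (fun k => (x.2 k : ℕ)) with hC
  set w : (Σ i : Fin N, (Fin n → Fin (p i))) → ℝ :=
    fun x => (1 : ℝ) / ((N : ℝ) * (p x.1 : ℝ) ^ n)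
  have hw0 : ∀ x, 0 ≤ w x := fun x => by positivity
  have hmean : ∑ x, w x * C x ≤ f.support.card * (1 / 16) := by
    have hswap : ∑ x, w x * C x = ∑ e ∈ f.support, ∑ x ∈ Finset.univ.filter
        (fun x : Σ i : Fin N, (Fin n → Fin (p i)) =>
          Collides f (p x.1) (fun k => (x.2 k : ℕ)) e), w x := by
      simp only [Finset.sum_filter]
      rw [Finset.sum_comm]
      refine Finset.sum_congr rfl fun x _ => ?_
      rw [← Finset.sum_filter, Finset.sum_const, nsmul_eq_mul, mul_comm]
      rfl
    rw [hswap, ← nsmul_eq_mul]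
    exact Finset.sum_le_card_nsmul _ _ _ fun e he => sum_filter_collides_le hD hNpos hNlog
      hprime hdist (fun i => le_trans (by omega) (hbig i)) he
  set B := Finset.univ.filter (fun x => 3 / 16 * (f.support.card : ℝ) < C x)
  have hB : ∑ x ∈ B, w x ≤ 1 / 3 := by
    have h := (mul_sum_filter_lt_le hw0 (fun x => Nat.cast_nonneg _ : ∀ x, 0 ≤ C x)
      (3 / 16 * (f.support.card : ℝ))).trans hmean
    refine le_of_mul_le_mul_left (h.trans_eq ?_) (by positivity : 0 < 3 / 16 * (f.support.card : ℝ))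
    ring
  have hBl : (∑ x ∈ B, w x) ^ l ≤ μ :=
    (pow_le_pow_left₀ (Finset.sum_nonneg fun x _ => hw0 x) hB l).trans
      (one_third_pow_le hμ0 hμ1 hlμ)
  refine (sub_le_sub_left hBl 1).trans
    (one_sub_pow_le_sum_filter hw0 (sum_one_div_mul_pow_eq_one hNpos fun i => (hprime i).pos)
      _ B fun ω hω j => ?_)
  by_contra hj
  refine hω fun j0 hj0 => ?_
  have hCj : C (ω j) ≤ 3 / 16 * (f.support.card : ℝ) := by
    simpa [B] using hj
  have hsplit : ∀ j, C (ω j) + ((f.support.filter (fun e =>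
      ¬ Collides f (p (ω j).1) (fun k => ((ω j).2 k : ℕ)) e)).card : ℝ) = f.support.card := by
    intro j
    simp only [hC, numCollide]
    exact_mod_cast Finset.card_filter_add_card_filter_not (s := f.support)
      (fun e => Collides f (p (ω j).1) (fun k => ((ω j).2 k : ℕ)) e)
  have hlower : ((f.support.filter (fun e =>
      ¬ Collides f (p (ω j).1) (fun k => ((ω j).2 k : ℕ)) e)).card : ℝ) ≤
      (kronMod (p (ω j0).1) (fun k => ((ω j0).2 k : ℕ)) f).support.card := by
    exact_mod_cast (card_filter_not_collides_le_card_support_kronMod (hprime _).pos _ f).trans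
      (hj0 j)
  have hupper : 2 * ((kronMod (p (ω j0).1) (fun k => ((ω j0).2 k : ℕ)) f).support.card : ℝ) +
      C (ω j0) ≤ 2 * f.support.card := by
    simp only [hC]
    exact_mod_cast two_mul_card_support_kronMod_add_numCollide_le (hprime _).pos _ f
  linarith [hsplit j, hsplit j0]

end
end

section
/- Let f ∈ R[x_1,…,x_n] with deg f ≤ D, let p be a positive integer, s ∈ ℕ^n, and suppose the term c·x^e of f (c ≠ 0, e = (e_1,…,e_n) ∈ ℕ^n) does not collide in f^mod_(p)(x^s). Set u = Σ_{k=1}^n e_k·s_k. Then: (i) u is the unique exponent in the support of f(x^s) that is congruent to u modulo p, and the coefficient of x^u in f(x^s) equals c; (ii) for each k = 1,…,n, setting b_k = u + p·e_k, b_k is the unique exponent in the support of f(x^{s+p·I_k}) that is congruent to u modulo p, and the coefficient of x^{b_k} in f(x^{s+p·I_k}) equals c; (iii) consequently e_k = (b_k − u)/p ∈ ℕ for each k, u = e_1 s_1 + ⋯ + e_n s_n, and Σ_{k=1}^n e_k ≤ D (so the term c·x^e belongs to the set TS_{(f,p,s,D)}). -/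
open scoped Classical

noncomputable section

theorem coeff_kron {R : Type*} [CommRing R] {n : ℕ} (s : Fin n → ℕ)
    (f : MvPolynomial (Fin n) R) (d : ℕ) :
    (kron s f).coeff d = ∑ e ∈ f.support, if d = dotProd s e then f.coeff e else 0 := by
  simp only [kron, MvPolynomial.eval₂_eq', Polynomial.finsetSum_coeff, dotProd,
    ← pow_mul, Finset.prod_pow_eq_pow_sum, Polynomial.coeff_C_mul_X_pow]
  congr!

theorem exists_dotProd_eq_of_mem_support_kron {R : Type*} [CommRing R] {n : ℕ}
    {s : Fin n → ℕ} {f : MvPolynomial (Fin n) R} {d : ℕ} (hd : d ∈ (kron s f).support) :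
    ∃ e ∈ f.support, d = dotProd s e := by
  rw [Polynomial.mem_support_iff, coeff_kron] at hd
  obtain ⟨e, he, hne⟩ := Finset.exists_ne_zero_of_sum_ne_zero hd
  exact ⟨e, he, by_contra fun h => hne (if_neg h)⟩

theorem kron_of_not_collides {R : Type*} [CommRing R] {n : ℕ}
    {f : MvPolynomial (Fin n) R} {p : ℕ} {s : Fin n → ℕ} {e : Fin n →₀ ℕ}
    (hnc : ¬ Collides f p s e) :
    (kron s f).coeff (dotProd s e) = f.coeff e ∧
      ∀ d ∈ (kron s f).support, d ≡ dotProd s e [MOD p] → d = dotProd s e := by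
  have eq_of_modEq : ∀ e' ∈ f.support, dotProd s e ≡ dotProd s e' [MOD p] → e' = e :=
    fun e' he' h => by_contra fun hne => hnc ⟨e', he', hne, h⟩
  refine ⟨?_, fun d hd hmod => ?_⟩
  · rw [coeff_kron, Finset.sum_eq_single e]
    · exact if_pos rfl
    · exact fun e' he' hne => if_neg fun h => hne (eq_of_modEq e' he' (congrArg (· % p) h))
    · intro he
      rw [if_pos rfl, MvPolynomial.notMem_support_iff.mp he]
  · obtain ⟨e', he', rfl⟩ := exists_dotProd_eq_of_mem_support_kron hd
    rw [eq_of_modEq e' he' hmod.symm]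

theorem dotProd_sShift {n : ℕ} (s : Fin n → ℕ) (p : ℕ) (k : Fin n) (e : Fin n →₀ ℕ) :
    dotProd (sShift s p k) e = dotProd s e + p * e k := by
  have h : ∀ j, sShift s p k j * e j = s j * e j + if j = k then p * e j else 0 := by
    intro j
    unfold sShift
    split_ifs <;> ring
  simp [dotProd, h, Finset.sum_add_distrib]

theorem dotProd_sShift_modEq {n : ℕ} (s : Fin n → ℕ) (p : ℕ) (k : Fin n) (e : Fin n →₀ ℕ) :
    dotProd (sShift s p k) e ≡ dotProd s e [MOD p] := by
  simp [dotProd_sShift, Nat.ModEq]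

theorem Collides.of_sShift {R : Type*} [CommRing R] {n : ℕ} {f : MvPolynomial (Fin n) R}
    {p : ℕ} {s : Fin n → ℕ} {k : Fin n} {e : Fin n →₀ ℕ}
    (h : Collides f p (sShift s p k) e) : Collides f p s e := by
  obtain ⟨e', he', hne, hmod⟩ := h
  exact ⟨e', he', hne,
    ((dotProd_sShift_modEq s p k e).symm.trans hmod).trans (dotProd_sShift_modEq s p k e')⟩

theorem noncolliding_term_recovery {R : Type*} [CommRing R] {n : ℕ}
    (f : MvPolynomial (Fin n) R) (D : ℕ) (hD : f.totalDegree ≤ D)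
    (p : ℕ) (hp : 0 < p) (s : Fin n → ℕ)
    (e : Fin n →₀ ℕ) (c : R) (hc : c ≠ 0) (hcoeff : MvPolynomial.coeff e f = c)
    (hnc : ¬ Collides f p s e)
    (u : ℕ) (hu : u = dotProd s e) :
    -- (i) `u` is the unique exponent in the support of `f(x^s)` congruent to `u`
    --     modulo `p`, and the coefficient of `x^u` in `f(x^s)` is `c`
    ((kron s f).coeff u = c ∧
      ∀ d ∈ (kron s f).support, d ≡ u [MOD p] → d = u) ∧
    -- (ii) for each `k`, `b_k = u + p·e_k` is the unique exponent in the support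
    --      of `f(x^{s+p·I_k})` congruent to `u` modulo `p`, with coefficient `c`
    (∀ k : Fin n,
      (kron (sShift s p k) f).coeff (u + p * e k) = c ∧
      ∀ d ∈ (kron (sShift s p k) f).support, d ≡ u [MOD p] → d = u + p * e k) ∧
    -- (iii) the exponents are recovered as `e_k = (b_k - u)/p`, `u = e·s`, and
    --       the total degree of the term is at most `D`
    (∀ k : Fin n, p ∣ (u + p * e k - u) ∧ (u + p * e k - u) / p = e k) ∧
    dotProd s e = u ∧ (∑ k, e k) ≤ D := by
  subst hu hcoeff
  refine ⟨kron_of_not_collides hnc, fun k => ?_, fun k => ?_, rfl, ?_⟩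
  · obtain ⟨hcoeff, hunique⟩ :=
      kron_of_not_collides (s := sShift s p k) (mt Collides.of_sShift hnc)
    rw [← dotProd_sShift]
    exact ⟨hcoeff, fun d hd h => hunique d hd (h.trans (dotProd_sShift_modEq s p k e).symm)⟩
  · rw [Nat.add_sub_cancel_left]
    exact ⟨dvd_mul_right p (e k), Nat.mul_div_cancel_left (e k) hp⟩
  · have h := MvPolynomial.le_totalDegree (MvPolynomial.mem_support_iff.mpr hc)
    rw [Finsupp.sum_fintype _ _ fun _ => rfl] at h
    exact h.trans hD

end
end

section
/- Let F be a field, let v_1,…,v_t ∈ F be pairwise distinct and nonzero, let c_1,…,c_t ∈ F be nonzero, and for k ∈ ℤ set a_k = Σ_{i=1}^t c_i v_i^k. Then for every integer i ≥ t−1, the t×t Toeplitz matrix T_{i,t−1} with entry a_{i−r+c} in row r and column c (0 ≤ r, c ≤ t−1) is nonsingular. -/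
/-- A Toeplitz matrix of power sums `∑ i, c i * v i ^ k` factors through two Vandermonde matrices
and a diagonal matrix. -/
theorem toeplitz_powerSum_eq_vandermonde_mul {F : Type*} [Field F] {t : ℕ}
    (v c : Fin t → F) (hv : ∀ j, v j ≠ 0) (m : ℤ) :
    (Matrix.of fun r s : Fin t =>
        ∑ j, c j * v j ^ (m - ((r : ℕ) : ℤ) + ((s : ℕ) : ℤ))) =
      (Matrix.vandermonde fun j => (v j)⁻¹).transpose *
        Matrix.diagonal (fun j => c j * v j ^ m) * Matrix.vandermonde v := by
  ext r s
  rw [Matrix.mul_apply]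
  simp only [Matrix.of_apply, Matrix.mul_diagonal, Matrix.transpose_apply,
    Matrix.vandermonde_apply]
  refine Finset.sum_congr rfl fun j _ => ?_
  rw [zpow_add₀ (hv j), zpow_sub₀ (hv j), zpow_natCast, zpow_natCast, inv_pow, div_eq_mul_inv]
  ring

theorem toeplitz_nonsingular {F : Type*} [Field F] (t : ℕ)
    (v c : Fin t → F)
    (hv0 : ∀ i, v i ≠ 0) (hvd : ∀ i j, i ≠ j → v i ≠ v j)
    (hc : ∀ i, c i ≠ 0)
    (a : ℤ → F) (ha : ∀ k : ℤ, a k = ∑ i, c i * v i ^ k)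
    (i : ℤ) (hi : (t : ℤ) - 1 ≤ i) :
    (Matrix.of fun r c' : Fin t => a (i - ((r : ℕ) : ℤ) + ((c' : ℕ) : ℤ))).det ≠ 0 := by
  have hinj : Function.Injective v := fun x y h => by_contra fun hne => hvd x y hne h
  simp only [ha]
  rw [toeplitz_powerSum_eq_vandermonde_mul v c hv0, Matrix.det_mul, Matrix.det_mul,
    Matrix.det_transpose, Matrix.det_diagonal]
  exact mul_ne_zero
    (mul_ne_zero (Matrix.det_vandermonde_ne_zero_iff.2 (inv_injective.comp hinj))
      (Finset.prod_ne_zero_iff.2 fun j _ => mul_ne_zero (hc j) (zpow_ne_zero _ (hv0 j))))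
    (Matrix.det_vandermonde_ne_zero_iff.2 hinj)
end
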